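/- For every set Σ of autoepistemic formulas, the set ℒae of all autoepistemic formulas is a stable expansion of Σ if and only if Σ ∪ SF^L(Σ) is inconsistent. -/

import Mathlib

/-- Autoepistemic formulas: propositional variables, Boolean connectives
`⊤, ⊥, ¬, ∧, ∨, ⊕`, and the modal operator `L` (`box`). -/
inductive AE : Type
  | var : ℕ → AE
  | top : AE
  | bot : AE
  | neg : AE → AE
  | conj : AE → AE → AE
  | disj : AE → AE → AE
  | xor : AE → AE → AE
  | box : AE → AE
  deriving DecidableEq

namespace AE

/-- Propositional evaluation of an autoepistemic formula, where `v` assigns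
truth values to propositional variables and `w` assigns truth values to
`L`-prefixed formulas (which are treated as atoms). -/
def eval (v : ℕ → Bool) (w : AE → Bool) : AE → Bool
  | var n => v n
  | top => true
  | bot => false
  | neg φ => !(eval v w φ)
  | conj φ ψ => eval v w φ && eval v w ψ
  | disj φ ψ => eval v w φ || eval v w ψ
  | xor φ ψ => (eval v w φ) != (eval v w ψ)
  | box φ => w φ

/-- Propositional consequence, treating `L`-prefixed formulas as atoms. -/
def entails (S : Set AE) (φ : AE) : Prop :=
  ∀ v w, (∀ ψ ∈ S, eval v w ψ = true) → eval v w φ = true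

/-- Deductive closure. -/
def Th (S : Set AE) : Set AE := {φ | entails S φ}

/-- `Δ` is a stable expansion of `S` if `Δ = Th (S ∪ L(Δ) ∪ ¬L(Δᶜ))`. -/
def IsStableExpansion (S Δ : Set AE) : Prop :=
  Δ = Th (S ∪ (box '' Δ) ∪ ((fun φ => neg (box φ)) '' Δᶜ))

/-- The set of subformulas of a formula (including the formula itself). -/
def subf : AE → Set AE
  | var n => {var n}
  | top => {top}
  | bot => {bot}
  | neg φ => insert (neg φ) (subf φ)
  | conj φ ψ => insert (conj φ ψ) (subf φ ∪ subf ψ)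
  | disj φ ψ => insert (disj φ ψ) (subf φ ∪ subf ψ)
  | xor φ ψ => insert (xor φ ψ) (subf φ ∪ subf ψ)
  | box φ => insert (box φ) (subf φ)

/-- `SF^L(S)`: the `L`-prefixed subformulas of formulas in `S`. -/
def SFL (S : Set AE) : Set AE := {χ | (∃ φ ∈ S, χ ∈ subf φ) ∧ ∃ ψ, χ = box ψ}

/-- `¬SF^L(S)`. -/
def negSFL (S : Set AE) : Set AE := neg '' SFL S

/-- `Λ` is an `S`-full set. -/
def IsFull (S Λ : Set AE) : Prop :=
  Λ ⊆ SFL S ∪ negSFL S ∧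
  ∀ φ, box φ ∈ SFL S →
    (entails (S ∪ Λ) φ ↔ box φ ∈ Λ) ∧ (¬ entails (S ∪ Λ) φ ↔ neg (box φ) ∈ Λ)


/-- Evaluation depends only on the values of the `L`-prefixed subformulas. -/
theorem eval_congr (v : ℕ → Bool) {w w' : AE → Bool} :
    ∀ φ : AE, (∀ ψ, box ψ ∈ subf φ → w ψ = w' ψ) → eval v w φ = eval v w' φ
  | var _, _ | top, _ | bot, _ => rfl
  | neg φ, h => by
    simp only [eval, eval_congr v φ fun ψ hψ => h ψ (Or.inr hψ)]
  | conj φ χ, h | disj φ χ, h | xor φ χ, h => by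
    simp only [eval, eval_congr v φ fun ψ hψ => h ψ (Or.inr (Or.inl hψ)),
      eval_congr v χ fun ψ hψ => h ψ (Or.inr (Or.inr hψ))]
  | box φ, h => h φ (Or.inl rfl)

/-- `ℒae` (i.e. the set of all autoepistemic formulas) is a stable expansion
of `Σ` iff `Σ ∪ SF^L(Σ)` is inconsistent. -/
theorem univ_stable_expansion_iff_inconsistent (S : Set AE) :
    IsStableExpansion S Set.univ ↔ entails (S ∪ SFL S) bot := by
  constructor
  · intro h v w hw
    have hbot : bot ∈ Th (S ∪ (box '' Set.univ) ∪ ((fun φ => neg (box φ)) '' Set.univᶜ)) :=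
      h ▸ Set.mem_univ bot
    refine hbot v (fun _ => true) ?_
    rintro ψ ((hψ | ⟨χ, -, rfl⟩) | ⟨χ, hχ, -⟩)
    · refine Eq.trans (eval_congr v ψ fun χ hχ => ?_) (hw ψ (Or.inl hψ))
      exact (hw (box χ) (Or.inr ⟨⟨ψ, hψ, hχ⟩, χ, rfl⟩)).symm
    · rfl
    · exact absurd (Set.mem_univ χ) hχ
  · intro h
    refine (Set.eq_univ_of_forall fun φ v w hw => ?_).symm
    refine absurd (h v w ?_) Bool.false_ne_true
    rintro ψ (hψ | ⟨-, χ, rfl⟩)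
    · exact hw ψ (Or.inl (Or.inl hψ))
    · exact hw (box χ) (Or.inl (Or.inr ⟨χ, Set.mem_univ χ, rfl⟩))

end AE
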